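/- arXiv:1401.5730 — 3 statements merged into one kernel-verified Lean document; each statement's English description precedes it below -/
import Mathlib

section
/- Let G be a finite connected loopless multigraph (weightless) and let δ be a divisor class on G. Then r_G(δ) = 0 if and only if there exist a vertex u and a representative d of δ such that d is u-reduced and d(u) = 0. -/
open Finset

variable {V : Type*} [Fintype V] [DecidableEq V]

/-- Intersection number `v · A`. -/
def dot (m : V → V → ℕ) (v : V) (A : Finset V) : ℤ := ∑ w ∈ A, (m v w : ℤ)

/-- The principal divisor `t_Z` associated to a set of vertices `Z`. -/
def tdiv (m : V → V → ℕ) (Z : Finset V) : V → ℤ :=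
  fun v => if v ∈ Z then -(dot m v Zᶜ) else dot m v Z

/-- The subgroup of principal divisors of the multigraph `(V, m)`. -/
def Prin (m : V → V → ℕ) : AddSubgroup (V → ℤ) :=
  AddSubgroup.closure (Set.range (tdiv m))

/-- A divisor is effective if all its values are nonnegative. -/
def Effective (d : V → ℤ) : Prop := ∀ v, 0 ≤ d v

/-- The degree of a divisor. -/
def deg (d : V → ℤ) : ℤ := ∑ v, d v

/-- `d` is linearly equivalent to an effective divisor. -/
def EquivEff (m : V → V → ℕ) (d : V → ℤ) : Prop :=
  ∃ e : V → ℤ, Effective e ∧ d - e ∈ Prin m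

/-- The Baker–Norine combinatorial rank of a divisor on a weightless loopless
multigraph: `-1` if `d` is not equivalent to an effective divisor, and otherwise
the largest `k ≥ 0` such that for every effective divisor `e` of degree `k`,
`d - e` is equivalent to an effective divisor. -/
noncomputable def bnrank (m : V → V → ℕ) (d : V → ℤ) : ℤ :=
  sSup ({-1} ∪ {k : ℤ | 0 ≤ k ∧
    ∀ e : V → ℤ, Effective e → deg e = k → EquivEff m (d - e)})

/-- Connectedness: any two vertices are joined by a path of edges of
positive multiplicity. -/
def Conn (m : V → V → ℕ) : Prop :=
  ∀ v w : V, Relation.ReflTransGen (fun a b => 0 < m a b) v w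

/-- `d` is `u`-reduced. -/
def Reduced (m : V → V → ℕ) (u : V) (d : V → ℤ) : Prop :=
  (∀ v, v ≠ u → 0 ≤ d v) ∧
  ∀ A : Finset V, A.Nonempty → u ∉ A → ∃ v ∈ A, d v < dot m v Aᶜ

open Classical in
/-- `ℓ_G(d)` for a weightless graph: the minimum value of `d` if `d` is
effective, and `-1` otherwise. -/
noncomputable def ell [Nonempty V] (d : V → ℤ) : ℤ :=
  if Effective d then Finset.univ.inf' Finset.univ_nonempty d else -1

/-- Edge multiplicities of the weightless loopless graph `Ĝ` associated to the
weighted graph `(V, m, g)`: for each `v` we add `g v` new vertices, each joined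
to `v` by two edges. -/
def hatm (m : V → V → ℕ) (g : V → ℕ) :
    (V ⊕ Σ v : V, Fin (g v)) → (V ⊕ Σ v : V, Fin (g v)) → ℕ
  | Sum.inl v, Sum.inl w => m v w
  | Sum.inl v, Sum.inr z => if z.1 = v then 2 else 0
  | Sum.inr z, Sum.inl w => if z.1 = w then 2 else 0
  | Sum.inr _, Sum.inr _ => 0

/-- Extension of a divisor on `G` to `Ĝ` by zero on the new vertices. -/
def hatd (g : V → ℕ) (d : V → ℤ) : (V ⊕ Σ v : V, Fin (g v)) → ℤ :=
  Sum.elim d fun _ => 0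

/-- The combinatorial rank of a divisor on the weighted graph `(V, m, g)`,
defined as the Baker–Norine rank of its extension to `Ĝ`. -/
noncomputable def wrank (m : V → V → ℕ) (g : V → ℕ) (d : V → ℤ) : ℤ :=
  bnrank (hatm m g) (hatd g d)

/-- `e^deg`, for an effective divisor `e` on a weighted graph. -/
def edeg (g : V → ℕ) (e : V → ℤ) : V → ℤ :=
  fun v => e v + min (e v) (g v : ℤ)

/-- `d_rk(v) = max (d v - g v) ⌊d v / 2⌋` (note `/` is floor division since
the divisor `2` is positive). -/
def drk (g : V → ℕ) (d : V → ℤ) : V → ℤ :=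
  fun v => max (d v - (g v : ℤ)) (d v / 2)

open Classical in
/-- `ℓ_G(d)` for a weighted graph. -/
noncomputable def ellw [Nonempty V] (g : V → ℕ) (d : V → ℤ) : ℤ :=
  if Effective d then Finset.univ.inf' Finset.univ_nonempty (drk g d) else -1

/-- The (negative) Laplacian of the multigraph `(V, m)`: the effect on divisors of firing each
vertex `v` exactly `f v` times. -/
def lap (m : V → V → ℕ) (f : V → ℤ) : V → ℤ := fun v => ∑ w, (m v w : ℤ) * (f w - f v)

lemma tdiv_eq_lap (m : V → V → ℕ) (Z : Finset V) :
    tdiv m Z = lap m (fun v => if v ∈ Z then 1 else 0) := by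
  funext v
  simp only [tdiv, dot, lap]
  split_ifs with h
  · rw [← Finset.sum_neg_distrib, ← Finset.sum_subset (Finset.subset_univ Zᶜ)]
    · refine Finset.sum_congr rfl fun w hw => ?_
      simp [Finset.mem_compl.1 hw]
    · intro w _ hw
      simp only [Finset.mem_compl, not_not] at hw
      simp [hw]
  · simp

lemma exists_lap_of_mem_Prin {m : V → V → ℕ} {p : V → ℤ} (hp : p ∈ Prin m) :
    ∃ f, p = lap m f := by
  induction hp using AddSubgroup.closure_induction with
  | mem x hx =>
    obtain ⟨Z, rfl⟩ := hx
    exact ⟨_, tdiv_eq_lap m Z⟩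
  | zero => exact ⟨0, by funext v; simp [lap]⟩
  | add x y _ _ hx hy =>
    obtain ⟨f, rfl⟩ := hx
    obtain ⟨g, rfl⟩ := hy
    refine ⟨f + g, ?_⟩
    funext v
    simp only [lap, Pi.add_apply, ← Finset.sum_add_distrib]
    exact Finset.sum_congr rfl fun w _ => by ring
  | neg x _ hx =>
    obtain ⟨f, rfl⟩ := hx
    refine ⟨-f, ?_⟩
    funext v
    simp only [lap, Pi.neg_apply, ← Finset.sum_neg_distrib]
    exact Finset.sum_congr rfl fun w _ => by ring

lemma sum_mul_lap_comm {V : Type*} [Fintype V] {m : V → V → ℕ} (hsymm : ∀ v w, m v w = m w v) (b f : V → ℤ) :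
    ∑ v, b v * lap m f v = ∑ v, f v * lap m b v := by
  have key : ∑ v, ∑ w, (m v w : ℤ) * (b v * f w) = ∑ v, ∑ w, (m v w : ℤ) * (f v * b w) := by
    rw [Finset.sum_comm]
    refine Finset.sum_congr rfl fun v _ => Finset.sum_congr rfl fun w _ => ?_
    rw [hsymm w v]
    ring
  have expand (x y : V → ℤ) : ∑ v, x v * lap m y v =
      ∑ v, ∑ w, (m v w : ℤ) * (x v * y w) - ∑ v, ∑ w, (m v w : ℤ) * (x v * y v) := by
    simp only [lap, Finset.mul_sum, ← Finset.sum_sub_distrib]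
    exact Finset.sum_congr rfl fun v _ => Finset.sum_congr rfl fun w _ => by ring
  rw [expand, expand, key]
  simp only [mul_comm (b _) (f _)]

lemma deg_eq_of_sub_mem_Prin {m : V → V → ℕ} (hsymm : ∀ v w, m v w = m w v) {d e : V → ℤ}
    (h : d - e ∈ Prin m) : deg d = deg e := by
  obtain ⟨f, hf⟩ := exists_lap_of_mem_Prin h
  have h0 : ∑ v, (d - e) v = 0 := by
    rw [hf]
    simpa [lap] using sum_mul_lap_comm hsymm (fun _ => 1) f
  simp only [Pi.sub_apply, Finset.sum_sub_distrib] at h0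
  simp only [deg]
  omega

/-- A connected multigraph carries a function that is strictly subharmonic away from `u`. -/
lemma exists_lap_pos {V : Type*} [Fintype V] {m : V → V → ℕ} (hsymm : ∀ v w, m v w = m w v)
    (hloop : ∀ v, m v v = 0) (hconn : Conn m) (u : V) :
    ∃ b : V → ℤ, (∀ v, 0 ≤ b v) ∧ ∀ v, v ≠ u → 0 < lap m b v := by
  let G : SimpleGraph V :=
    { Adj := fun v w => 0 < m v w
      symm := ⟨fun v w h => by simpa [hsymm w v] using h⟩
      loopless := ⟨fun v h => by simp [hloop] at h⟩ }
  have hreach (v w : V) : G.Reachable v w :=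
    (SimpleGraph.reachable_iff_reflTransGen v w).2 (hconn v w)
  let C : ℤ := 1 + ∑ v, ∑ w, (m v w : ℤ)
  let D : ℕ := ∑ v, G.dist v u
  have hC : 0 < C := by positivity
  refine ⟨fun v => C ^ (D - G.dist v u), fun v => by positivity, fun v hv => ?_⟩
  obtain ⟨w, hvw, hdist⟩ : ∃ w, 0 < m v w ∧ G.dist v u = G.dist w u + 1 := by
    obtain ⟨p, hp⟩ := (hreach v u).exists_walk_length_eq_dist
    cases p with
    | nil => exact absurd rfl hv
    | @cons _ w _ h q =>
      refine ⟨w, h, le_antisymm ?_ ?_⟩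
      · obtain ⟨r, hr⟩ := (hreach w u).exists_walk_length_eq_dist
        simpa [hr] using SimpleGraph.dist_le (SimpleGraph.Walk.cons h r)
      · rw [← hp, SimpleGraph.Walk.length_cons]
        exact Nat.add_le_add_right (SimpleGraph.dist_le q) 1
  have hD : G.dist v u ≤ D :=
    Finset.single_le_sum (f := fun v => G.dist v u) (fun _ _ => Nat.zero_le _) (Finset.mem_univ v)
  have hpow : C ^ (D - G.dist w u) = C * C ^ (D - G.dist v u) := by
    rw [← pow_succ']
    congr 1
    omega
  have hdeg : ∑ x, (m v x : ℤ) < C := by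
    have := Finset.single_le_sum (f := fun v => ∑ x, (m v x : ℤ))
      (fun _ _ => by positivity) (Finset.mem_univ v)
    simp only [C]
    linarith
  have hle : (m v w : ℤ) * C ^ (D - G.dist w u) ≤ ∑ x, (m v x : ℤ) * C ^ (D - G.dist x u) :=
    Finset.single_le_sum (f := fun x => (m v x : ℤ) * C ^ (D - G.dist x u))
      (fun _ _ => by positivity) (Finset.mem_univ w)
  have hb : 0 < C ^ (D - G.dist v u) := by positivity
  have hm : (1 : ℤ) ≤ m v w := by exact_mod_cast hvw
  simp only [lap, mul_sub, Finset.sum_sub_distrib, ← Finset.sum_mul]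
  rw [hpow] at hle
  nlinarith [mul_lt_mul_of_pos_right hdeg hb, mul_le_mul_of_nonneg_right hm (mul_pos hC hb).le]

/-- Every effective divisor is equivalent to an effective `u`-reduced divisor. -/
lemma exists_effective_reduced {m : V → V → ℕ} (hsymm : ∀ v w, m v w = m w v)
    (hloop : ∀ v, m v v = 0) (hconn : Conn m) (u : V) {e : V → ℤ} (he : Effective e) :
    ∃ d, Effective d ∧ d - e ∈ Prin m ∧ Reduced m u d := by
  obtain ⟨b, hb, hlap⟩ := exists_lap_pos hsymm hloop hconn u
  let P : ℤ → Prop := fun z => ∃ d, Effective d ∧ d - e ∈ Prin m ∧ ∑ v, b v * d v = z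
  have hbdd : ∀ z, P z → z ≤ ∑ v, b v * deg e := by
    rintro z ⟨d, hd, hde, rfl⟩
    refine Finset.sum_le_sum fun v _ => mul_le_mul_of_nonneg_left ?_ (hb v)
    rw [← deg_eq_of_sub_mem_Prin hsymm hde]
    exact Finset.single_le_sum (fun w _ => hd w) (Finset.mem_univ v)
  obtain ⟨z, ⟨d, hd, hde, rfl⟩, hmax⟩ :=
    Int.exists_greatest_of_bdd ⟨_, hbdd⟩ ⟨_, e, he, by simp [(Prin m).zero_mem], rfl⟩
  refine ⟨d, hd, hde, fun v _ => hd v, fun A hA huA => ?_⟩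
  by_contra! hfire
  have hpos : 0 < ∑ v, b v * tdiv m A v := by
    rw [tdiv_eq_lap, sum_mul_lap_comm hsymm]
    simp only [ite_mul, one_mul, zero_mul, Finset.sum_ite_mem, Finset.univ_inter]
    exact Finset.sum_pos (fun v hv => hlap v fun h => huA (h ▸ hv)) hA
  have hle := hmax (∑ v, b v * (d + tdiv m A) v) ⟨d + tdiv m A, fun v => ?_, ?_, rfl⟩
  · simp only [Pi.add_apply, mul_add, Finset.sum_add_distrib] at hle
    linarith
  · by_cases hv : v ∈ A
    · have := hfire v hv
      simp only [Pi.add_apply, tdiv, hv, if_true]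
      linarith
    · have : 0 ≤ dot m v A := Finset.sum_nonneg fun _ _ => by positivity
      simp only [Pi.add_apply, tdiv, hv, if_false]
      linarith [hd v]
  · rw [add_sub_right_comm]
    exact (Prin m).add_mem hde (AddSubgroup.subset_closure ⟨A, rfl⟩)

/-- A `u`-reduced divisor that is negative at `u` is not equivalent to an effective one. -/
lemma Reduced.not_equivEff {m : V → V → ℕ} {u : V} {d : V → ℤ} (h : Reduced m u d)
    (hu : d u < 0) : ¬ EquivEff m d := by
  rintro ⟨e, he, hde⟩
  obtain ⟨f, hf⟩ := exists_lap_of_mem_Prin ((Prin m).neg_mem hde)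
  have hev (v : V) : e v = d v + lap m f v := by
    have := congrFun hf v
    simp only [Pi.neg_apply, Pi.sub_apply] at this
    omega
  obtain ⟨x, -, hx⟩ := Finset.exists_max_image Finset.univ f ⟨u, Finset.mem_univ u⟩
  let A : Finset V := {v | f v = f x}
  have hlap (v : V) (hv : v ∈ A) : lap m f v ≤ -dot m v Aᶜ := by
    have hv : f v = f x := by simpa [A] using hv
    have hterm (w : V) : (m v w : ℤ) * (f w - f v) ≤ 0 :=
      mul_nonpos_of_nonneg_of_nonpos (by positivity) (by linarith [hx w (Finset.mem_univ w)])
    simp only [lap, dot]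
    rw [← Finset.sum_add_sum_compl A, ← Finset.sum_neg_distrib]
    have h1 : ∑ w ∈ A, (m v w : ℤ) * (f w - f v) ≤ 0 := Finset.sum_nonpos fun w _ => hterm w
    have h2 : ∑ w ∈ Aᶜ, (m v w : ℤ) * (f w - f v) ≤ ∑ w ∈ Aᶜ, -(m v w : ℤ) := by
      refine Finset.sum_le_sum fun w hw => ?_
      have hne : f w ≠ f x := by simpa [A] using hw
      have := lt_of_le_of_ne (hx w (Finset.mem_univ w)) hne
      nlinarith [Int.natCast_nonneg (m v w)]
    linarith
  by_cases huA : u ∈ A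
  · have : 0 ≤ dot m u Aᶜ := Finset.sum_nonneg fun _ _ => by positivity
    linarith [hlap u huA, hev u, he u]
  · obtain ⟨v, hv, hlt⟩ := h.2 A ⟨x, by simp [A]⟩ huA
    linarith [hlap v hv, hev v, he v]

lemma EquivEff.of_sub_mem_Prin {m : V → V → ℕ} {d d' : V → ℤ} (h : EquivEff m d)
    (hd : d' - d ∈ Prin m) : EquivEff m d' := by
  obtain ⟨e, he, hde⟩ := h
  exact ⟨e, he, by simpa using (Prin m).add_mem hd hde⟩

lemma Effective.exists_eq_single {e : V → ℤ} (he : Effective e) (h1 : deg e = 1) :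
    ∃ u, e = Pi.single u 1 := by
  obtain ⟨u, -, hu⟩ : ∃ u ∈ Finset.univ, 0 < e u :=
    Finset.exists_lt_of_sum_lt (f := fun _ => (0 : ℤ)) (by
      rw [Finset.sum_const_zero]
      exact one_pos.trans_eq h1.symm)
  have hsum : e u + ∑ v ∈ Finset.univ.erase u, e v = 1 := by
    rw [Finset.add_sum_erase _ _ (Finset.mem_univ u)]
    exact h1
  have hnn : 0 ≤ ∑ v ∈ Finset.univ.erase u, e v := Finset.sum_nonneg fun v _ => he v
  refine ⟨u, funext fun v => ?_⟩
  by_cases hv : v = u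
  · subst hv
    rw [Pi.single_eq_same]
    omega
  · have := Finset.single_le_sum (fun w _ => he w)
      (Finset.mem_erase.2 ⟨hv, Finset.mem_univ v⟩)
    rw [Pi.single_eq_of_ne hv]
    have := he v
    omega

/-- The rank vanishes iff the divisor is equivalent to an effective one, but ceases to be so after
removing a chip from a suitable vertex. -/
lemma bnrank_eq_zero_iff [Nonempty V] {m : V → V → ℕ} (hsymm : ∀ v w, m v w = m w v)
    (d : V → ℤ) :
    bnrank m d = 0 ↔ EquivEff m d ∧ ∃ u, ¬ EquivEff m (d - Pi.single u 1) := by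
  let S : Set ℤ := {-1} ∪ {k : ℤ | 0 ≤ k ∧
    ∀ e : V → ℤ, Effective e → deg e = k → EquivEff m (d - e)}
  have hsingle (u : V) (k : ℤ) : deg (Pi.single u k) = k := by simp [deg]
  have heff (u : V) {k : ℤ} (hk : 0 ≤ k) : Effective (Pi.single u k) := fun v => by
    by_cases hv : v = u
    · subst hv
      simpa using hk
    · simp [hv]
  have hbdd : BddAbove S := by
    refine ⟨max (-1) (deg d), ?_⟩
    rintro k (rfl | ⟨hk, h⟩)
    · exact le_max_left _ _
    · obtain ⟨u⟩ := ‹Nonempty V›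
      obtain ⟨e, he, hde⟩ := h _ (heff u hk) (hsingle u k)
      have h1 := deg_eq_of_sub_mem_Prin hsymm hde
      have h2 : 0 ≤ deg e := Finset.sum_nonneg fun v _ => he v
      have h3 : deg (d - Pi.single u k) = deg d - k := by
        rw [← hsingle u k]
        simp [deg]
      exact le_max_of_le_right (by linarith)
  have hne : S.Nonempty := ⟨-1, Or.inl rfl⟩
  change sSup S = 0 ↔ _
  constructor
  · intro h
    have h0 : (0 : ℤ) ∈ S := h ▸ Int.csSup_mem hne hbdd
    refine ⟨?_, ?_⟩
    · obtain h0 | ⟨-, h0⟩ := h0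
      · simp at h0
      · simpa using h0 0 (fun _ => le_rfl) (by simp [deg])
    · by_contra! hall
      have h1 : (1 : ℤ) ∈ S := by
        refine Or.inr ⟨one_pos.le, fun e he h1 => ?_⟩
        obtain ⟨u, rfl⟩ := he.exists_eq_single h1
        exact hall u
      have := le_csSup hbdd h1
      omega
  · rintro ⟨⟨e, he, hde⟩, u, hu⟩
    refine le_antisymm (csSup_le hne ?_) (le_csSup hbdd (Or.inr ⟨le_rfl, fun e' he' h0 => ?_⟩))
    · rintro k (rfl | ⟨-, h⟩)
      · norm_num
      · by_contra! hk
        obtain ⟨e', he', hde'⟩ := h _ (heff u hk.le) (hsingle u k)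
        refine hu ⟨e' + Pi.single u (k - 1), fun v => ?_, ?_⟩
        · exact add_nonneg (he' v) (heff u (by omega : 0 ≤ k - 1) v)
        · convert hde' using 1
          rw [Pi.single_sub]
          abel
    · have : e' = 0 := funext fun v =>
        (Finset.sum_eq_zero_iff_of_nonneg fun w _ => he' w).1 h0 v (Finset.mem_univ v)
      subst this
      exact ⟨e, he, by simpa using hde⟩

/-- `r_G(δ) = 0` iff some representative `d` of the class `δ` is `u`-reduced
for some vertex `u` with `d u = 0`. -/
theorem stmt5 {V : Type*} [Fintype V] [DecidableEq V] [Nonempty V]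
    (m : V → V → ℕ) (hsymm : ∀ v w, m v w = m w v) (hloop : ∀ v, m v v = 0)
    (hconn : Conn m) (d₀ : V → ℤ) :
    bnrank m d₀ = 0 ↔
      ∃ (u : V) (d : V → ℤ), d - d₀ ∈ Prin m ∧ Reduced m u d ∧ d u = 0 := by
  rw [bnrank_eq_zero_iff hsymm]
  constructor
  · rintro ⟨⟨e, he, hde⟩, u, hu⟩
    obtain ⟨d, hd, hde', hred⟩ := exists_effective_reduced hsymm hloop hconn u he
    have hdd : d₀ - d ∈ Prin m := by simpa using (Prin m).sub_mem hde hde'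
    refine ⟨u, d, by simpa using (Prin m).neg_mem hdd, hred, le_antisymm ?_ (hd u)⟩
    by_contra! hpos
    refine hu ⟨d - Pi.single u 1, fun v => ?_, by simpa using hdd⟩
    by_cases hv : v = u
    · subst hv
      simp only [Pi.sub_apply, Pi.single_eq_same]
      omega
    · simpa [hv] using hd v
  · rintro ⟨u, d, hdd, hred, hdu⟩
    have hd : Effective d := fun v => by
      by_cases hv : v = u
      · rw [hv, hdu]
      · exact hred.1 v hv
    refine ⟨⟨d, hd, by simpa using (Prin m).neg_mem hdd⟩, u, fun h => ?_⟩
    have hred' : Reduced m u (d - Pi.single u 1) := by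
      refine ⟨fun v hv => by simpa [hv] using hd v, fun A hA huA => ?_⟩
      obtain ⟨v, hv, hlt⟩ := hred.2 A hA huA
      have hvu : v ≠ u := fun h => huA (h ▸ hv)
      exact ⟨v, hv, by simpa [hvu] using hlt⟩
    exact hred'.not_equivEff (by simp [hdu]) (h.of_sub_mem_Prin (by simpa using hdd))
end

section
/- Let G be a finite connected loopless multigraph (weightless) and let d be a divisor on G. Suppose there exists a vertex u with d(u) = ℓ_G(d) such that d is u-reduced. Then r_G(d) = ℓ_G(d). -/
open Finset

variable {V : Type*} [Fintype V] [DecidableEq V]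

theorem tdiv_eq_sum (m : V → V → ℕ) (Z : Finset V) (v : V) :
    tdiv m Z v =
      ∑ w, (m v w : ℤ) * ((if w ∈ Z then 1 else 0) - (if v ∈ Z then 1 else 0)) := by
  unfold tdiv dot
  by_cases hv : v ∈ Z
  · rw [if_pos hv, ← Finset.sum_neg_distrib, ← Finset.sum_subset (Finset.subset_univ Zᶜ)]
    · refine Finset.sum_congr rfl fun w hw => ?_
      simp [hv, Finset.mem_compl.1 hw]
    · intro w _ hw
      have hwZ : w ∈ Z := by simpa using hw
      simp [hv, hwZ]
  · rw [if_neg hv, ← Finset.sum_subset (Finset.subset_univ Z)]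
    · refine Finset.sum_congr rfl fun w hw => ?_
      simp [hv, hw]
    · intro w _ hw
      simp [hv, hw]

/-- Every principal divisor is the Laplacian of an integer-valued function on the vertices. -/
theorem exists_laplacian_of_mem_Prin (m : V → V → ℕ) {p : V → ℤ} (hp : p ∈ Prin m) :
    ∃ f : V → ℤ, ∀ v, p v = ∑ w, (m v w : ℤ) * (f w - f v) := by
  induction hp using AddSubgroup.closure_induction with
  | mem x hx =>
    obtain ⟨Z, rfl⟩ := hx
    exact ⟨fun w => if w ∈ Z then 1 else 0, tdiv_eq_sum m Z⟩
  | zero => exact ⟨0, fun v => by simp⟩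
  | add x y _ _ hx hy =>
    obtain ⟨f, hf⟩ := hx
    obtain ⟨g, hg⟩ := hy
    refine ⟨f + g, fun v => ?_⟩
    rw [Pi.add_apply, hf, hg, ← Finset.sum_add_distrib]
    refine Finset.sum_congr rfl fun w _ => ?_
    simp only [Pi.add_apply]
    ring
  | neg x _ hx =>
    obtain ⟨f, hf⟩ := hx
    refine ⟨-f, fun v => ?_⟩
    rw [Pi.neg_apply, hf, ← Finset.sum_neg_distrib]
    refine Finset.sum_congr rfl fun w _ => ?_
    simp only [Pi.neg_apply]
    ring

theorem dot_nonneg (m : V → V → ℕ) (v : V) (A : Finset V) : 0 ≤ dot m v A :=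
  Finset.sum_nonneg fun _ _ => Int.natCast_nonneg _

/-- A `u`-reduced divisor that is equivalent to an effective one is nonnegative at `u`. -/
theorem Reduced.nonneg_of_equivEff {m : V → V → ℕ} {u : V} {d : V → ℤ}
    (hred : Reduced m u d) (hd : EquivEff m d) : 0 ≤ d u := by
  obtain ⟨e, he, hde⟩ := hd
  obtain ⟨f, hf⟩ := exists_laplacian_of_mem_Prin m hde
  obtain ⟨a, -, ha⟩ := Finset.exists_min_image Finset.univ f ⟨u, Finset.mem_univ u⟩
  have hmin : ∀ w, f a ≤ f w := fun w => ha w (Finset.mem_univ w)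
  let A : Finset V := Finset.univ.filter fun v => f v = f a
  have hmem : ∀ v, v ∈ A ↔ f v = f a := fun v => by simp [A]
  have hle : ∀ v ∈ A, dot m v Aᶜ ≤ d v := by
    intro v hv
    have hva := (hmem v).1 hv
    have hsum : dot m v Aᶜ ≤ ∑ w, (m v w : ℤ) * (f w - f v) := by
      calc dot m v Aᶜ ≤ ∑ w ∈ Aᶜ, (m v w : ℤ) * (f w - f v) := by
            refine Finset.sum_le_sum fun w hw => ?_
            have hwa : f w ≠ f a := fun h => Finset.mem_compl.1 hw ((hmem w).2 h)
            have := hmin w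
            exact le_mul_of_one_le_right (Int.natCast_nonneg _) (by omega)
        _ ≤ ∑ w, (m v w : ℤ) * (f w - f v) := by
            refine Finset.sum_le_sum_of_subset_of_nonneg (Finset.subset_univ _) fun w _ _ => ?_
            have := hmin w
            exact mul_nonneg (Int.natCast_nonneg _) (by omega)
    have h1 := hf v
    have h2 := he v
    rw [Pi.sub_apply] at h1
    omega
  by_cases huA : u ∈ A
  · exact (dot_nonneg m u Aᶜ).trans (hle u huA)
  · obtain ⟨v, hv, hlt⟩ := hred.2 A ⟨a, (hmem a).2 rfl⟩ huA
    exact absurd (hle v hv) (not_le.2 hlt)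

/-- Changing the value at `u` preserves being `u`-reduced. -/
theorem Reduced.sub_single {m : V → V → ℕ} {u : V} {d : V → ℤ} (hred : Reduced m u d) (k : ℤ) :
    Reduced m u (d - Pi.single u k) := by
  refine ⟨fun v hv => by simpa [hv] using hred.1 v hv, fun A hA huA => ?_⟩
  obtain ⟨v, hv, hlt⟩ := hred.2 A hA huA
  have hvu : v ≠ u := fun h => huA (h ▸ hv)
  exact ⟨v, hv, by simpa [hvu] using hlt⟩

theorem Effective.le_deg {e : V → ℤ} (he : Effective e) (v : V) : e v ≤ deg e :=
  Finset.single_le_sum (fun w _ => he w) (Finset.mem_univ v)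

theorem Effective.equivEff {d : V → ℤ} (m : V → V → ℕ) (hd : Effective d) : EquivEff m d :=
  ⟨d, hd, by simp [(Prin m).zero_mem]⟩

/-- If `d` is `u`-reduced for a vertex `u` with `d u = ℓ_G(d)`, then
`r_G(d) = ℓ_G(d)`. -/
theorem stmt6 {V : Type*} [Fintype V] [DecidableEq V] [Nonempty V]
    (m : V → V → ℕ) (hsymm : ∀ v w, m v w = m w v) (hloop : ∀ v, m v v = 0)
    (hconn : Conn m) (d : V → ℤ) (u : V)
    (hu : d u = ell d) (hred : Reduced m u d) :
    bnrank m d = ell d := by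
  refine IsGreatest.csSup_eq ⟨?_, ?_⟩
  · by_cases hd : Effective d
    · have hle : ∀ v, ell d ≤ d v := fun v => by
        rw [ell, if_pos hd]
        exact Finset.inf'_le d (Finset.mem_univ v)
      refine Or.inr ⟨hu ▸ hd u, fun e he hdeg => Effective.equivEff m fun v => ?_⟩
      exact sub_nonneg.2 ((he.le_deg v).trans (hdeg.le.trans (hle v)))
    · exact Or.inl (by simp [ell, hd])
  · rintro k (rfl | ⟨hk, h⟩)
    · by_cases hd : Effective d
      · have := hd u
        omega
      · simp [ell, hd]
    · have heff : Effective (Pi.single u k : V → ℤ) := fun v => by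
        by_cases hv : v = u
        · subst hv
          simpa using hk
        · simp [hv]
      have := (hred.sub_single k).nonneg_of_equivEff (h _ heff (by simp [deg]))
      rw [Pi.sub_apply, Pi.single_eq_same] at this
      omega
end

section
/- Let G be a weighted graph and let d be a divisor on G. Then r_G(d) ≥ ℓ_G(d), where ℓ_G(d) = min_{v∈V} max(d(v) − g(v), ⌊d(v)/2⌋) if d is effective and ℓ_G(d) = −1 otherwise. -/
open Finset

variable {V : Type*} [Fintype V] [DecidableEq V]

theorem deg_tdiv {V : Type*} [Fintype V] [DecidableEq V] (m : V → V → ℕ)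
    (hsymm : ∀ v w, m v w = m w v) (Z : Finset V) : deg (tdiv m Z) = 0 := by
  unfold deg
  rw [← Finset.sum_add_sum_compl Z]
  have h1 : ∑ v ∈ Z, tdiv m Z v = -∑ v ∈ Z, ∑ w ∈ Zᶜ, (m v w : ℤ) := by
    rw [← Finset.sum_neg_distrib]
    exact Finset.sum_congr rfl fun v hv => by simp [tdiv, hv, dot]
  have h2 : ∑ v ∈ Zᶜ, tdiv m Z v = ∑ v ∈ Zᶜ, ∑ w ∈ Z, (m v w : ℤ) :=
    Finset.sum_congr rfl fun v hv => by simp [tdiv, Finset.mem_compl.1 hv, dot]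
  rw [h1, h2, Finset.sum_comm]
  simp_rw [hsymm]
  ring

theorem deg_eq_zero_of_mem_Prin {V : Type*} [Fintype V] [DecidableEq V] {m : V → V → ℕ}
    (hsymm : ∀ v w, m v w = m w v) {d : V → ℤ} (hd : d ∈ Prin m) : deg d = 0 := by
  induction hd using AddSubgroup.closure_induction with
  | mem x hx =>
    obtain ⟨Z, rfl⟩ := hx
    exact deg_tdiv m hsymm Z
  | zero => simp [deg]
  | add x y _ _ hx hy =>
    simp only [deg, Pi.add_apply, Finset.sum_add_distrib] at *
    omega
  | neg x _ hx =>
    simp only [deg, Pi.neg_apply, Finset.sum_neg_distrib] at *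
    omega

theorem bddAbove_rank_set {V : Type*} [Fintype V] [DecidableEq V] [Nonempty V]
    {m : V → V → ℕ} (hsymm : ∀ v w, m v w = m w v) (d : V → ℤ) :
    BddAbove ({-1} ∪ {k : ℤ | 0 ≤ k ∧
      ∀ e : V → ℤ, Effective e → deg e = k → EquivEff m (d - e)}) := by
  refine ⟨max (-1) (deg d), ?_⟩
  rintro k (rfl | ⟨hk, h⟩)
  · exact le_max_left _ _
  · refine le_max_of_le_right ?_
    obtain ⟨v₀⟩ := ‹Nonempty V›
    obtain ⟨f, hf, hfP⟩ := h (Pi.single v₀ k)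
      (fun v => (Pi.single_nonneg.2 hk : (0 : V → ℤ) ≤ Pi.single v₀ k) v) (by simp [deg])
    have h0 := deg_eq_zero_of_mem_Prin hsymm hfP
    have hf0 : 0 ≤ ∑ v, f v := Finset.sum_nonneg fun v _ => hf v
    simp only [deg, Pi.sub_apply, Finset.sum_sub_distrib, Finset.sum_pi_single',
      Finset.mem_univ, if_true] at h0 ⊢
    linarith

theorem hatm_symm {V : Type*} [DecidableEq V] {m : V → V → ℕ}
    (hsymm : ∀ v w, m v w = m w v) (g : V → ℕ) (x y : V ⊕ Σ v : V, Fin (g v)) :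
    hatm m g x y = hatm m g y x := by
  rcases x with v | z <;> rcases y with w | z' <;> simp [hatm, hsymm]

theorem tdiv_hatm_singleton_inl {V : Type*} [Fintype V] [DecidableEq V] (m : V → V → ℕ)
    (g : V → ℕ) (z : Σ v : V, Fin (g v)) (v : V) :
    tdiv (hatm m g) {Sum.inr z} (Sum.inl v) = if z.1 = v then 2 else 0 := by
  simp [tdiv, dot, hatm]

theorem tdiv_hatm_singleton_inr {V : Type*} [Fintype V] [DecidableEq V] (m : V → V → ℕ)
    (g : V → ℕ) (z y : Σ v : V, Fin (g v)) :
    tdiv (hatm m g) {Sum.inr z} (Sum.inr y) = if z = y then -2 else 0 := by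
  by_cases h : z = y
  · subst h
    have hs : dot (hatm m g) (Sum.inr z) {Sum.inr z} +
        dot (hatm m g) (Sum.inr z) {Sum.inr z}ᶜ = 2 := by
      unfold dot
      rw [Finset.sum_add_sum_compl]
      simp [hatm]
    simp only [tdiv, Finset.mem_singleton, if_true]
    simp [dot, hatm] at hs ⊢
    simpa [hatm] using hs
  · simp [tdiv, dot, hatm, h, Ne.symm h]

/-- Chips can be moved in pairs from each vertex to the genus vertices attached to it. -/
theorem equivEff_hatd_sub {V : Type*} [Fintype V] [DecidableEq V] (m : V → V → ℕ)
    (g : V → ℕ) (d : V → ℤ) (e : (V ⊕ Σ v : V, Fin (g v)) → ℤ)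
    (h : ∀ v, e (Sum.inl v) + ∑ i, 2 * ((e (Sum.inr ⟨v, i⟩) + 1) / 2) ≤ d v) :
    EquivEff (hatm m g) (hatd g d - e) := by
  set c : (Σ v : V, Fin (g v)) → ℤ := fun z => (e (Sum.inr z) + 1) / 2 with hc
  set s : (V ⊕ Σ v : V, Fin (g v)) → ℤ :=
    ∑ z, c z • tdiv (hatm m g) {Sum.inr z} with hs
  refine ⟨hatd g d - e - s, ?_, ?_⟩
  · rintro (v | z)
    · have : s (Sum.inl v) = ∑ i, 2 * c ⟨v, i⟩ := by
        simp only [hs, Finset.sum_apply, Pi.smul_apply, tdiv_hatm_singleton_inl, smul_eq_mul]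
        rw [Fintype.sum_sigma, Finset.sum_eq_single v]
        · simp [mul_comm]
        · intro w _ hw
          simp [hw]
        · simp
      have hv := h v
      simp only [Pi.sub_apply, hatd, Sum.elim_inl, this, hc]
      linarith
    · have : s (Sum.inr z) = -2 * c z := by
        simp [hs, Finset.sum_apply, tdiv_hatm_singleton_inr, mul_comm]
      simp only [Pi.sub_apply, hatd, Sum.elim_inr, this, hc]
      omega
  · rw [sub_sub_cancel]
    exact sum_mem fun z _ =>
      zsmul_mem (AddSubgroup.subset_closure (Set.mem_range_self {Sum.inr z})) _

theorem add_sum_two_mul_ceil_half_le {ι : Type*} [Fintype ι] {a k D : ℤ} {b : ι → ℤ}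
    (ha : 0 ≤ a) (hb : ∀ i, 0 ≤ b i) (hk : a + ∑ i, b i ≤ k)
    (hD : k ≤ max (D - Fintype.card ι) (D / 2)) :
    a + ∑ i, 2 * ((b i + 1) / 2) ≤ D := by
  rcases le_max_iff.1 hD with h | h
  · have : ∑ i, 2 * ((b i + 1) / 2) ≤ ∑ i, (b i + 1) :=
      Finset.sum_le_sum fun i _ => by omega
    simp only [Finset.sum_add_distrib, Finset.sum_const, Finset.card_univ, nsmul_eq_mul,
      mul_one] at this
    linarith
  · have : ∑ i, 2 * ((b i + 1) / 2) ≤ ∑ i, 2 * b i :=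
      Finset.sum_le_sum fun i _ => by have := hb i; omega
    rw [← Finset.mul_sum (f := b)] at this
    omega

/-- On a weighted graph, `r_G(d) ≥ ℓ_G(d)`, where
`ℓ_G(d) = min_v max (d v - g v) ⌊d v / 2⌋` if `d` is effective and `-1`
otherwise. -/
theorem stmt9 {V : Type*} [Fintype V] [DecidableEq V] [Nonempty V]
    (m : V → V → ℕ) (hsymm : ∀ v w, m v w = m w v) (hloop : ∀ v, m v v = 0)
    (hconn : Conn m) (g : V → ℕ) (d : V → ℤ) :
    ellw g d ≤ wrank m g d := by
  have : Nonempty (V ⊕ Σ v : V, Fin (g v)) := ⟨Sum.inl (Classical.arbitrary V)⟩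
  refine le_csSup (bddAbove_rank_set (hatm_symm hsymm g) _) ?_
  unfold ellw
  split_ifs with hd
  · right
    have hle : ∀ v, univ.inf' univ_nonempty (drk g d) ≤ drk g d v :=
      fun v => Finset.inf'_le _ (mem_univ v)
    refine ⟨Finset.le_inf' _ _ fun v _ => le_max_of_le_right ?_, fun e he hdeg => ?_⟩
    · have := hd v
      omega
    · refine equivEff_hatd_sub m g d e fun v => ?_
      refine add_sum_two_mul_ceil_half_le (he _) (fun i => he _) (k := deg e) ?_ ?_
      · rw [deg, Fintype.sum_sum_type, Fintype.sum_sigma]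
        refine add_le_add
          (Finset.single_le_sum (f := fun v => e (Sum.inl v)) (fun w _ => he _) (mem_univ v))
          (Finset.single_le_sum (f := fun v => ∑ i, e (Sum.inr ⟨v, i⟩))
            (fun w _ => Finset.sum_nonneg fun i _ => he _) (mem_univ v))
      · simpa [hdeg, drk] using hle v
  · left
    rfl
end
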